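/- Let p ≥ 1, d ≥ 0, n = 2p + d, and let N be the n×n real skew-symmetric matrix in block form [[0, vI_p, 0],[−vI_p, 0, 0],[0, 0, 0]] for a nonzero real number v. Then the real vector space { Y ∈ Sym(n) : YN = NY } has dimension p² + d(d+1)/2. Consequently, every symplectic leaf of the frozen Poisson structure with tensor C_X(Y) = YN − NY is p(p+1+2d)-dimensional. -/

import Mathlib

open Matrix

/-- Symmetric matrices from functions on unordered pairs. -/
def symMap (ι : Type) : (Sym2 ι → ℝ) →ₗ[ℝ] Matrix ι ι ℝ where
  toFun f := Matrix.of fun i j => f s(i, j)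
  map_add' f g := by ext i j; simp
  map_smul' c f := by ext i j; simp

theorem symMap_inj (ι : Type) : Function.Injective (symMap ι) := by
  intro f g h
  funext z
  induction z using Sym2.ind with
  | _ i j => exact congrFun (congrFun h i) j

theorem symMap_exists {ι : Type} (Y : Matrix ι ι ℝ) (h : ∀ i j, Y j i = Y i j) :
    ∃ f, symMap ι f = Y :=
  ⟨fun z => Sym2.lift ⟨fun i j => Y i j, fun i j => (h i j).symm⟩ z, by
    ext i j; simp [symMap]⟩

theorem mem_sym {ι : Type} (Y : Matrix ι ι ℝ) :
    Y ∈ LinearMap.ker ((transposeLinearEquiv ι ι ℝ ℝ).toLinearMap - LinearMap.id) ↔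
      ∀ i j, Y j i = Y i j := by
  rw [LinearMap.mem_ker, LinearMap.sub_apply, sub_eq_zero]
  constructor
  · intro h i j
    exact congrFun (congrFun h i) j
  · intro h
    ext i j
    exact h i j

theorem finrank_sym (ι : Type) [Fintype ι] [DecidableEq ι] :
    Module.finrank ℝ
      ↥(LinearMap.ker ((transposeLinearEquiv ι ι ℝ ℝ).toLinearMap - LinearMap.id))
      = (Fintype.card ι + 1).choose 2 := by
  have : LinearMap.ker ((transposeLinearEquiv ι ι ℝ ℝ).toLinearMap - LinearMap.id)
      = LinearMap.range (symMap ι) := by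
    ext Y
    rw [mem_sym]
    constructor
    · intro h
      exact symMap_exists Y h
    · rintro ⟨f, rfl⟩ i j
      simp [symMap, Sym2.eq_swap]
  rw [this, LinearMap.finrank_range_of_inj (symMap_inj ι), Module.finrank_fintype_fun_eq_card,
    Sym2.card]

/-- Parametrization of the kernel. -/
def kerMap (p d : ℕ) : (Matrix (Fin p) (Fin p) ℝ × (Sym2 (Fin d) → ℝ)) →ₗ[ℝ]
    Matrix ((Fin p ⊕ Fin p) ⊕ Fin d) ((Fin p ⊕ Fin p) ⊕ Fin d) ℝ where
  toFun x := fromBlocks (fromBlocks (x.1 + x.1ᵀ) (x.1 - x.1ᵀ) (x.1ᵀ - x.1) (x.1 + x.1ᵀ))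
    0 0 (symMap _ x.2)
  map_add' x y := by
    ext ((i | i) | i) ((j | j) | j) <;> simp <;> ring
  map_smul' c x := by
    ext ((i | i) | i) ((j | j) | j) <;> simp <;> ring

theorem kerMap_inj (p d : ℕ) : Function.Injective (kerMap p d) := by
  rintro ⟨M, f⟩ ⟨M', f'⟩ h
  have h' := fun i j => congrFun (congrFun h i) j
  refine Prod.ext ?_ (symMap_inj _ ?_)
  · ext i j
    have h1 := h' (.inl (.inl i)) (.inl (.inl j))
    have h2 := h' (.inl (.inl i)) (.inl (.inr j))
    simp [kerMap] at h1 h2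
    show M i j = M' i j
    linarith
  · ext i j
    simpa [kerMap] using h' (.inr i) (.inr j)

theorem ker_eq (p d : ℕ) (v : ℝ) (hv : v ≠ 0)
    (N : Matrix ((Fin p ⊕ Fin p) ⊕ Fin d) ((Fin p ⊕ Fin p) ⊕ Fin d) ℝ)
    (hN : N = fromBlocks
        (fromBlocks 0 (v • (1 : Matrix (Fin p) (Fin p) ℝ))
          (-(v • (1 : Matrix (Fin p) (Fin p) ℝ))) 0) 0 0 0) :
    (LinearMap.ker
            ((transposeLinearEquiv ((Fin p ⊕ Fin p) ⊕ Fin d)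
                ((Fin p ⊕ Fin p) ⊕ Fin d) ℝ ℝ).toLinearMap - LinearMap.id)
          ⊓ LinearMap.ker
              (LinearMap.mulRight ℝ N - LinearMap.mulLeft ℝ N))
      = LinearMap.range (kerMap p d) := by
  ext Y
  rw [Submodule.mem_inf, mem_sym, LinearMap.mem_ker, LinearMap.sub_apply, sub_eq_zero,
    LinearMap.mulRight_apply, LinearMap.mulLeft_apply]
  constructor
  · rintro ⟨hs, hc⟩
    obtain ⟨A, B, C, E, rfl⟩ : ∃ A B C E, Y = fromBlocks A B C E :=
      ⟨_, _, _, _, (fromBlocks_toBlocks Y).symm⟩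
    obtain ⟨A1, A2, A3, A4, rfl⟩ : ∃ A1 A2 A3 A4, A = fromBlocks A1 A2 A3 A4 :=
      ⟨_, _, _, _, (fromBlocks_toBlocks A).symm⟩
    have h' := fun i j => congrFun (congrFun hc i) j
    obtain ⟨f, hf⟩ := symMap_exists E (fun i j => hs (.inr i) (.inr j))
    have e1 : ∀ i j, A2 i j = - A3 i j := fun i j => by
      have := h' (.inl (.inl i)) (.inl (.inl j))
      simp [hN, fromBlocks_multiply] at this
      apply mul_left_cancel₀ hv; linarith
    have e2 : ∀ i j, A1 i j = A4 i j := fun i j => by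
      have := h' (.inl (.inl i)) (.inl (.inr j))
      simp [hN, fromBlocks_multiply, hv] at this
      exact this
    have s1 : ∀ i j, A1 j i = A1 i j := fun i j => hs (.inl (.inl i)) (.inl (.inl j))
    have s2 : ∀ i j, A3 j i = A2 i j := fun i j => hs (.inl (.inl i)) (.inl (.inr j))
    have c1 : ∀ i j, C i (.inl j) = 0 := fun i j => by
      have := h' (.inr i) (.inl (.inr j))
      simpa [hN, fromBlocks_multiply, Matrix.mul_apply, Matrix.one_apply, hv] using this
    have c2 : ∀ i j, C i (.inr j) = 0 := fun i j => by
      have := h' (.inr i) (.inl (.inl j))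
      simpa [hN, fromBlocks_multiply, Matrix.mul_apply, Matrix.one_apply, hv] using this
    have b : ∀ i j, B j i = C i j := fun i j => hs (.inr i) (.inl j)
    refine ⟨((1 / 2 : ℝ) • (A1 + A2), f), ?_⟩
    ext ((i | i) | i) ((j | j) | j)
    · simp [kerMap]; linarith [s1 i j, s2 i j, e1 i j, e1 j i, e2 i j, s2 j i]
    · simp [kerMap]; linarith [s1 i j, s2 i j, e1 i j, e1 j i, e2 i j, s2 j i]
    · simp [kerMap, b, c1]
    · simp [kerMap]; linarith [s1 i j, s2 i j, e1 i j, e1 j i, e2 i j, s2 j i]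
    · simp [kerMap]; linarith [s1 i j, s2 i j, e1 i j, e1 j i, e2 i j, s2 j i]
    · simp [kerMap, b, c2]
    · simp [kerMap, c1]
    · simp [kerMap, c2]
    · simp [kerMap, hf]
  · rintro ⟨⟨M, f⟩, rfl⟩
    constructor
    · rintro ((i | i) | i) ((j | j) | j) <;> simp [kerMap, symMap, Sym2.eq_swap] <;> ring
    · rw [hN]
      ext ((i | i) | i) ((j | j) | j) <;> simp [kerMap, fromBlocks_multiply] <;> ring

/-- For `N = [[0,vI_p,0],[−vI_p,0,0],[0,0,0]]` with `v ≠ 0`, the space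
`{Y ∈ Sym(n) : YN = NY}` (the kernel of the frozen Poisson tensor
`C_X(Y) = YN − NY`) has dimension `p² + d(d+1)/2`; consequently, every
symplectic leaf of the frozen Poisson structure, whose dimension is the rank
of `C_X` on `Sym(n)`, is `p(p+1+2d)`-dimensional. -/
theorem stmt10 (p d : ℕ) (hp : 1 ≤ p) (v : ℝ) (hv : v ≠ 0)
    (N : Matrix ((Fin p ⊕ Fin p) ⊕ Fin d) ((Fin p ⊕ Fin p) ⊕ Fin d) ℝ)
    (hN : N = fromBlocks
        (fromBlocks 0 (v • (1 : Matrix (Fin p) (Fin p) ℝ))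
          (-(v • (1 : Matrix (Fin p) (Fin p) ℝ))) 0) 0 0 0) :
    Module.finrank ℝ
        ↥(LinearMap.ker
            ((transposeLinearEquiv ((Fin p ⊕ Fin p) ⊕ Fin d)
                ((Fin p ⊕ Fin p) ⊕ Fin d) ℝ ℝ).toLinearMap - LinearMap.id)
          ⊓ LinearMap.ker
              (LinearMap.mulRight ℝ N - LinearMap.mulLeft ℝ N))
        = p * p + d * (d + 1) / 2 ∧
    Module.finrank ℝ
        ↥(Submodule.map (LinearMap.mulRight ℝ N - LinearMap.mulLeft ℝ N)
            (LinearMap.ker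
              ((transposeLinearEquiv ((Fin p ⊕ Fin p) ⊕ Fin d)
                  ((Fin p ⊕ Fin p) ⊕ Fin d) ℝ ℝ).toLinearMap - LinearMap.id)))
        = p * (p + 1 + 2 * d) := by
  have h1 : (d + 1).choose 2 = d * (d + 1) / 2 := by
    rw [Nat.choose_two_right, Nat.add_sub_cancel, mul_comm]
  have hk := ker_eq p d v hv N hN
  have hfk : Module.finrank ℝ (LinearMap.range (kerMap p d)) = p * p + d * (d + 1) / 2 := by
    rw [LinearMap.finrank_range_of_inj (kerMap_inj p d), Module.finrank_prod,
      Module.finrank_matrix, Module.finrank_fintype_fun_eq_card, Sym2.card]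
    simp [h1]
  refine ⟨by rw [hk]; exact hfk, ?_⟩
  have hS := finrank_sym ((Fin p ⊕ Fin p) ⊕ Fin d)
  generalize LinearMap.ker ((transposeLinearEquiv ((Fin p ⊕ Fin p) ⊕ Fin d)
    ((Fin p ⊕ Fin p) ⊕ Fin d) ℝ ℝ).toLinearMap - LinearMap.id) = S at *
  generalize (LinearMap.mulRight ℝ N - LinearMap.mulLeft ℝ N) = T at *
  have hr := LinearMap.finrank_range_add_finrank_ker (T.domRestrict S)
  rw [LinearMap.range_domRestrict, hS] at hr
  have hk2 : Module.finrank ℝ (LinearMap.ker (T.domRestrict S))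
      = p * p + d * (d + 1) / 2 := by
    rw [← hfk, ← hk, ← Submodule.map_comap_subtype, LinearMap.ker_domRestrict]
    exact (Submodule.finrank_map_subtype_eq _ _).symm
  rw [hk2] at hr
  simp only [Fintype.card_sum, Fintype.card_fin, Nat.choose_two_right, Nat.add_sub_cancel] at hr
  have a1 : 2 * (d * (d + 1) / 2) = d * (d + 1) :=
    Nat.mul_div_cancel' (Nat.even_mul_succ_self d).two_dvd
  have a2 : 2 * ((p + p + d + 1) * (p + p + d) / 2) = (p + p + d + 1) * (p + p + d) :=
    Nat.mul_div_cancel' (by rw [mul_comm]; exact (Nat.even_mul_succ_self _).two_dvd)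
  nlinarith
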